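/- Let p ≥ 3 be an integer and F : ℝ^{p−1} → ℝ a smooth function. For 0 < ε < 2 set r(ε) := 2·arcsin(ε/2), β(ε) := (∫₀^{r(ε)} (1 − cos t)(sin t)^{p−2} dt)/(∫₀^{r(ε)} (1 − cos t)²(sin t)^{p−2} dt + ε^{p+7}), and K_ε(t) := 1 − (1 − cos t)·β(ε). Then, as ε → 0⁺, (∫_{S^{p−2}} ∫₀^{r(ε)} K_ε(t)·F(tθ)·(sin t)^{p−2} dt dσ(θ))/(∫_{S^{p−2}} ∫₀^{r(ε)} K_ε(t)·(sin t)^{p−2} dt dσ(θ)) − F(0) = −((p² − 1)/(24·|S^{p−2}|·(p+3)(p+5)))·(∫_{S^{p−2}} D⁴F(0)[θ,θ,θ,θ] dσ(θ) + ∫_{S^{p−2}} D²F(0)[θ,θ] dσ(θ))·ε⁴ + O(ε⁶), where D^kF(0)[θ,…,θ] is the k-th derivative of s ↦ F(sθ) at s = 0. -/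

import Mathlib

open Asymptotics Filter Topology MeasureTheory

/-- The parametrization of a face of the unit sphere by a face of the cube, through radial
projection. -/
noncomputable def cubeFaceToSphere (m : ℕ) (i : Fin (m + 2)) (s : ℝ) (y : Fin (m + 1) → ℝ) :
    EuclideanSpace ℝ (Fin (m + 2)) :=
  ‖WithLp.toLp 2 (i.insertNth s y : Fin (m + 2) → ℝ)‖⁻¹ • WithLp.toLp 2 (i.insertNth s y)

theorem contDiff_cubeFaceToSphere (m : ℕ) (i : Fin (m + 2)) {s : ℝ} (hs : s ≠ 0) :
    ContDiff ℝ 1 (cubeFaceToSphere m i s) := by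
  have h : ContDiff ℝ 1 fun y : Fin (m + 1) → ℝ =>
      (WithLp.toLp 2 (i.insertNth s y) : EuclideanSpace ℝ (Fin (m + 2))) := by
    refine contDiff_euclidean.2 fun j => ?_
    refine Fin.succAboveCases i ?_ (fun k => ?_) j
    · simpa using contDiff_const
    · simpa using contDiff_apply ℝ ℝ k
  have hne (y : Fin (m + 1) → ℝ) :
      (WithLp.toLp 2 (i.insertNth s y) : EuclideanSpace ℝ (Fin (m + 2))) ≠ 0 := by
    intro h0
    apply hs
    simpa using congrArg (fun v : EuclideanSpace ℝ (Fin (m + 2)) => v i) h0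
  exact ((h.norm ℝ hne).inv fun y => norm_ne_zero_iff.2 (hne y)).smul h

theorem sphere_subset_iUnion_cubeFaceToSphere (m : ℕ) :
    Metric.sphere (0 : EuclideanSpace ℝ (Fin (m + 2))) 1 ⊆
      ⋃ i, (cubeFaceToSphere m i 1 '' Set.Icc (-1) 1 ∪
        cubeFaceToSphere m i (-1) '' Set.Icc (-1) 1) := by
  intro x hx
  have hx1 : ‖x‖ = 1 := by simpa using hx
  obtain ⟨i, hi⟩ := Finite.exists_max fun j => |x j|
  have hpos : 0 < |x i| := by
    by_contra! h
    have h0 : x = 0 := by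
      ext j
      exact abs_nonpos_iff.1 ((hi j).trans h)
    simp [h0] at hx1
  have key (s : ℝ) (hs : x i = |x i| * s) :
      x ∈ cubeFaceToSphere m i s '' Set.Icc (-1) 1 := by
    refine ⟨fun k => |x i|⁻¹ * x (i.succAbove k), ?_, ?_⟩
    · have hb (k) : |(|x i|⁻¹ * x (i.succAbove k))| ≤ 1 := by
        rw [abs_mul, abs_inv, abs_abs, inv_mul_le_iff₀ hpos, mul_one]
        exact hi _
      exact ⟨fun k => (abs_le.1 (hb k)).1, fun k => (abs_le.1 (hb k)).2⟩
    · have hv : (WithLp.toLp 2 (i.insertNth s fun k => |x i|⁻¹ * x (i.succAbove k)) :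
          EuclideanSpace ℝ (Fin (m + 2))) = |x i|⁻¹ • x := by
        ext j
        refine Fin.succAboveCases i ?_ (fun k => ?_) j
        · simp only [Fin.insertNth_apply_same, PiLp.smul_apply, smul_eq_mul]
          rw [eq_inv_mul_iff_mul_eq₀ hpos.ne']
          exact hs.symm
        · simp
      rw [cubeFaceToSphere, hv, norm_smul, hx1, smul_smul]
      simp [hpos.ne']
  refine Set.mem_iUnion.2 ⟨i, ?_⟩
  rcases abs_choice (x i) with h | h
  · exact Or.inl (key 1 (by rw [h, mul_one]))
  · exact Or.inr (key (-1) (by rw [h]; ring))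

theorem hausdorffMeasure_sphere_lt_top (m : ℕ) :
    μH[(m + 1 : ℕ)] (Metric.sphere (0 : EuclideanSpace ℝ (Fin (m + 2))) 1) < ⊤ := by
  have key (i : Fin (m + 2)) {s : ℝ} (hs : s ≠ 0) :
      μH[(m + 1 : ℕ)] (cubeFaceToSphere m i s '' Set.Icc (-1) 1) < ⊤ := by
    obtain ⟨K, hK⟩ := (contDiff_cubeFaceToSphere m i hs).contDiffOn.exists_lipschitzOnWith
      one_ne_zero (convex_Icc (-1 : Fin (m + 1) → ℝ) 1) isCompact_Icc
    refine (hK.hausdorffMeasure_image_le (d := (m + 1 : ℕ)) (by positivity)).trans_lt ?_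
    have hvol : (μH[(m + 1 : ℕ)] : Measure (Fin (m + 1) → ℝ)) = volume := by
      simpa using hausdorffMeasure_pi_real (ι := Fin (m + 1))
    rw [hvol]
    exact ENNReal.mul_lt_top (ENNReal.rpow_lt_top_of_nonneg (by positivity) ENNReal.coe_ne_top)
      isCompact_Icc.measure_lt_top
  refine (measure_mono (sphere_subset_iUnion_cubeFaceToSphere m)).trans_lt ?_
  refine (measure_iUnion_le _).trans_lt ?_
  rw [tsum_fintype]
  refine ENNReal.sum_lt_top.2 fun i _ => (measure_union_le _ _).trans_lt ?_
  exact ENNReal.add_lt_top.2 ⟨key i one_ne_zero, key i (by norm_num)⟩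

theorem hausdorffMeasure_sphere_pos (m : ℕ) :
    0 < μH[(m + 1 : ℕ)] (Metric.sphere (0 : EuclideanSpace ℝ (Fin (m + 2))) 1) := by
  let P : EuclideanSpace ℝ (Fin (m + 2)) → (Fin (m + 1) → ℝ) := fun x k => x k.succ
  have hP : LipschitzWith 1 P := by
    refine LipschitzWith.of_dist_le_mul fun x y => ?_
    rw [NNReal.coe_one, one_mul, dist_pi_le_iff dist_nonneg]
    intro k
    simpa [dist_eq_norm] using PiLp.norm_apply_le (x - y) k.succ
  have hvol : (μH[(m + 1 : ℕ)] : Measure (Fin (m + 1) → ℝ)) = volume := by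
    simpa using hausdorffMeasure_pi_real (ι := Fin (m + 1))
  have hsub : {y : Fin (m + 1) → ℝ | ∑ k, y k ^ 2 < 1} ⊆
      P '' Metric.sphere (0 : EuclideanSpace ℝ (Fin (m + 2))) 1 := by
    intro y hy
    refine ⟨WithLp.toLp 2 (Fin.cons √(1 - ∑ k, y k ^ 2) y), ?_, ?_⟩
    · have hy' : 0 ≤ 1 - ∑ k, y k ^ 2 := sub_nonneg.2 (le_of_lt hy)
      rw [mem_sphere_zero_iff_norm, EuclideanSpace.norm_eq, Fin.sum_univ_succ]
      simp [Real.sq_sqrt hy']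
    · ext k
      simp [P]
  have hopen : IsOpen {y : Fin (m + 1) → ℝ | ∑ k, y k ^ 2 < 1} :=
    isOpen_lt (by fun_prop) continuous_const
  have hpos : 0 < (volume : Measure (Fin (m + 1) → ℝ)) {y | ∑ k, y k ^ 2 < 1} :=
    hopen.measure_pos _ ⟨0, by simp⟩
  have hle := hP.hausdorffMeasure_image_le (d := (m + 1 : ℕ)) (by positivity)
    (Metric.sphere (0 : EuclideanSpace ℝ (Fin (m + 2))) 1)
  rw [hvol] at hle
  simpa using hpos.trans_le ((measure_mono hsub).trans hle)

theorem setIntegral_sphere_hausdorffMeasure_neg {E : Type*} [NormedAddCommGroup E]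
    [MeasurableSpace E] [BorelSpace E] (d : ℝ) (f : E → ℝ) :
    ∫ θ in Metric.sphere (0 : E) 1, f (-θ) ∂μH[d] = ∫ θ in Metric.sphere (0 : E) 1, f θ ∂μH[d] := by
  have h := ((IsometryEquiv.neg E).measurePreserving_hausdorffMeasure d).setIntegral_preimage_emb
    (IsometryEquiv.neg E).toHomeomorph.measurableEmbedding f (Metric.sphere (0 : E) 1)
  simpa using h

section DirectionalTaylor

variable {E : Type*} [NormedAddCommGroup E] [NormedSpace ℝ E] {F : E → ℝ}

theorem iteratedDeriv_smul_right_eq (hF : ContDiff ℝ (⊤ : ℕ∞) F) (k : ℕ) (θ : E) (s : ℝ) :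
    iteratedDeriv k (fun s : ℝ => F (s • θ)) s = iteratedFDeriv ℝ k F (s • θ) fun _ => θ := by
  have h := (ContinuousLinearMap.toSpanSingleton ℝ θ).iteratedFDeriv_comp_right hF s (i := k)
    (by exact_mod_cast le_top)
  have h2 : F ∘ (ContinuousLinearMap.toSpanSingleton ℝ θ) = fun s : ℝ => F (s • θ) := by
    ext; simp
  rw [h2] at h
  rw [iteratedDeriv_eq_iteratedFDeriv, h]
  simp

theorem continuous_iteratedDeriv_smul_zero (hF : ContDiff ℝ (⊤ : ℕ∞) F) (k : ℕ) :
    Continuous fun θ : E => iteratedDeriv k (fun s : ℝ => F (s • θ)) 0 := by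
  simp only [iteratedDeriv_smul_right_eq hF, zero_smul]
  exact (iteratedFDeriv ℝ k F 0).cont.comp (continuous_pi fun _ => continuous_id)

theorem iteratedDeriv_smul_neg_zero (hF : ContDiff ℝ (⊤ : ℕ∞) F) (k : ℕ) (θ : E) :
    iteratedDeriv k (fun s : ℝ => F (s • -θ)) 0 =
      (-1) ^ k * iteratedDeriv k (fun s : ℝ => F (s • θ)) 0 := by
  simp only [iteratedDeriv_smul_right_eq hF, zero_smul]
  simpa using (iteratedFDeriv ℝ k F 0).map_smul_univ (fun _ => (-1 : ℝ)) (fun _ => θ)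

theorem exists_forall_abs_sub_taylor_smul_le [ProperSpace E] (hF : ContDiff ℝ (⊤ : ℕ∞) F) (n : ℕ) :
    ∃ C, ∀ θ ∈ Metric.sphere (0 : E) 1, ∀ t ∈ Set.Icc (0 : ℝ) 1,
      |F (t • θ) - ∑ k ∈ Finset.range (n + 1),
        t ^ k / k.factorial * iteratedDeriv k (fun s : ℝ => F (s • θ)) 0| ≤ C * t ^ (n + 1) := by
  have hcont : Continuous (iteratedFDeriv ℝ (n + 1) F) :=
    hF.continuous_iteratedFDeriv (by exact_mod_cast le_top)
  obtain ⟨C, hC⟩ := (isCompact_closedBall (0 : E) 1).exists_bound_of_continuousOn hcont.continuousOn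
  refine ⟨C / n.factorial, fun θ hθ t ht => ?_⟩
  have hθ1 : ‖θ‖ = 1 := by simpa using hθ
  have hg : ContDiff ℝ (⊤ : ℕ∞) fun s : ℝ => F (s • θ) := by fun_prop
  have hk (k : ℕ) {y : ℝ} (hy : y ∈ Set.Icc (0 : ℝ) 1) :
      iteratedDerivWithin k (fun s : ℝ => F (s • θ)) (Set.Icc 0 1) y =
        iteratedDeriv k (fun s : ℝ => F (s • θ)) y :=
    iteratedDerivWithin_eq_iteratedDeriv (uniqueDiffOn_Icc one_pos)
      (hg.contDiffAt.of_le (by exact_mod_cast le_top)) hy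
  have h := taylor_mean_remainder_bound (n := n) (C := C) zero_le_one
    (hg.contDiffOn.of_le (by exact_mod_cast le_top)) ht fun y hy => by
      rw [hk _ hy, iteratedDeriv_smul_right_eq hF]
      refine (ContinuousMultilinearMap.le_opNorm _ _).trans ?_
      simp only [hθ1, Finset.prod_const_one, mul_one]
      refine hC _ ?_
      simpa [norm_smul, hθ1, abs_of_nonneg hy.1] using hy.2
  rw [taylor_within_apply, Real.norm_eq_abs] at h
  simp only [sub_zero, hk _ (Set.left_mem_Icc.2 zero_le_one), smul_eq_mul] at h
  convert h using 1
  · congr 3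
    ext k
    ring
  · ring

end DirectionalTaylor

/-- `g x = c + O(x ^ 2)` as `x → 0⁺`. -/
def HasQuadraticError (g : ℝ → ℝ) (c : ℝ) : Prop :=
  (fun x => g x - c) =O[𝓝[>] (0 : ℝ)] fun x => x ^ 2

namespace HasQuadraticError

variable {g h : ℝ → ℝ} {c d : ℝ}

theorem tendsto (hg : HasQuadraticError g c) : Tendsto g (𝓝[>] 0) (𝓝 c) := by
  have h0 : Tendsto (fun x : ℝ => x ^ 2) (𝓝[>] 0) (𝓝 0) := by
    have : Tendsto (fun x : ℝ => x ^ 2) (𝓝 0) (𝓝 (0 ^ 2)) := (continuous_pow 2).tendsto 0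
    simpa using this.mono_left nhdsWithin_le_nhds
  simpa using (hg.trans_tendsto h0).add_const c

theorem congr' (hg : HasQuadraticError g c) (hgh : g =ᶠ[𝓝[>] 0] h) : HasQuadraticError h c :=
  IsBigO.congr' hg (hgh.mono fun x hx => by simp only [hx]) EventuallyEq.rfl

theorem of_abs_sub_le (C : ℝ) (hg : ∀ᶠ x in 𝓝[>] (0 : ℝ), |g x - c| ≤ C * x ^ 2) :
    HasQuadraticError g c :=
  IsBigO.of_bound C (hg.mono fun x hx => by simpa using hx)

theorem const (c : ℝ) : HasQuadraticError (fun _ => c) c :=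
  of_abs_sub_le 0 (by simp)

theorem sq : HasQuadraticError (fun x => x ^ 2) 0 :=
  of_abs_sub_le 1 (by simp)

theorem add (hg : HasQuadraticError g c) (hh : HasQuadraticError h d) :
    HasQuadraticError (fun x => g x + h x) (c + d) :=
  (IsBigO.add hg hh).congr_left fun x => by ring

theorem sub (hg : HasQuadraticError g c) (hh : HasQuadraticError h d) :
    HasQuadraticError (fun x => g x - h x) (c - d) :=
  (IsBigO.sub hg hh).congr_left fun x => by ring

theorem mul (hg : HasQuadraticError g c) (hh : HasQuadraticError h d) :
    HasQuadraticError (fun x => g x * h x) (c * d) := by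
  have h1 : (fun x => (g x - c) * h x) =O[𝓝[>] (0 : ℝ)] fun x => x ^ 2 := by
    simpa using IsBigO.mul hg (hh.tendsto.isBigO_one ℝ)
  exact (h1.add (IsBigO.const_mul_left hh c)).congr_left fun x => by ring

theorem pow (hg : HasQuadraticError g c) (n : ℕ) :
    HasQuadraticError (fun x => g x ^ n) (c ^ n) := by
  induction n with
  | zero => simpa using const 1
  | succ n ih => simpa only [pow_succ] using ih.mul hg

theorem inv (hg : HasQuadraticError g c) (hc : c ≠ 0) :
    HasQuadraticError (fun x => (g x)⁻¹) c⁻¹ := by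
  have h1 : (fun x => (c - g x) * ((g x)⁻¹ * c⁻¹)) =O[𝓝[>] (0 : ℝ)] fun x => x ^ 2 := by
    have h2 : (fun x => c - g x) =O[𝓝[>] (0 : ℝ)] fun x => x ^ 2 :=
      (IsBigO.neg_left hg).congr_left fun x => by ring
    simpa using h2.mul (((hg.tendsto.inv₀ hc).mul_const c⁻¹).isBigO_one ℝ)
  refine h1.congr' ?_ EventuallyEq.rfl
  filter_upwards [hg.tendsto.eventually_ne hc] with x hx
  field_simp

theorem div (hg : HasQuadraticError g c) (hh : HasQuadraticError h d) (hd : d ≠ 0) :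
    HasQuadraticError (fun x => g x / h x) (c / d) := by
  simpa only [div_eq_mul_inv] using hg.mul (hh.inv hd)

end HasQuadraticError

theorem hasQuadraticError_sin_div : HasQuadraticError (fun t => Real.sin t / t) 1 := by
  refine .of_abs_sub_le 1 ?_
  filter_upwards [self_mem_nhdsWithin] with t (ht : 0 < t)
  have h1 := Real.sin_lt ht
  have h2 := Real.sin_gt_sub_cube ht
  have h3 : 0 < t ^ 3 := by positivity
  rw [div_sub_one ht.ne', abs_div, abs_of_pos ht, div_le_iff₀ ht, abs_le]
  constructor <;> nlinarith

theorem hasQuadraticError_one_sub_cos_div :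
    HasQuadraticError (fun t => (1 - Real.cos t) / t ^ 2) (1 / 2) := by
  refine .of_abs_sub_le 1 ?_
  filter_upwards [Ioc_mem_nhdsGT one_pos] with t ht
  have h := abs_le.1 (Real.cos_bound (abs_le.2 ⟨by linarith [ht.1], ht.2⟩))
  have ht2 : 0 < t ^ 2 := by have := ht.1; positivity
  have h4 : |t| ^ 4 = t ^ 2 * t ^ 2 := by rw [abs_of_pos ht.1]; ring
  have h5 : 0 < t ^ 2 * t ^ 2 := by positivity
  rw [h4] at h
  have : (1 - Real.cos t) / t ^ 2 - 1 / 2 = (1 - Real.cos t - t ^ 2 / 2) / t ^ 2 := by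
    rw [sub_div _ (t ^ 2 / 2), div_div_cancel_left' ht2.ne', one_div]
  rw [this, abs_div, abs_of_pos ht2, div_le_iff₀ ht2, abs_le]
  constructor <;> nlinarith [h.1, h.2]

theorem abs_sq_sub_two_mul_one_sub_cos_le {t : ℝ} (ht : t ∈ Set.Icc (0 : ℝ) 1) :
    |t ^ 2 - 2 * (1 - Real.cos t) - t ^ 4 / 12| ≤ t ^ 6 := by
  obtain ⟨h0, h1⟩ := ht
  set x := t / 2 with hx
  have hx0 : 0 ≤ x := by positivity
  have hx1 : x ≤ 1 := by linarith
  have h := Real.sin_bound (abs_le.2 ⟨by linarith, hx1⟩)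
  rw [abs_of_nonneg hx0] at h
  have hcos : Real.cos t = 1 - 2 * Real.sin x ^ 2 := by
    rw [show t = 2 * x by rw [hx]; ring, Real.cos_two_mul, Real.cos_sq']
    ring
  have ht2 : t = 2 * x := by rw [hx]; ring
  obtain ⟨e, he⟩ : ∃ e, Real.sin x = x - x ^ 3 / 6 + e := ⟨_, (add_sub_cancel _ _).symm⟩
  rw [he, add_sub_cancel_left] at h
  have hexpr : t ^ 2 - 2 * (1 - Real.cos t) - t ^ 4 / 12 =
      -(x ^ 6 / 9) - 4 * e * (2 * (x - x ^ 3 / 6) + e) := by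
    rw [hcos, he, ht2]; ring
  have hx5 : x ^ 5 ≤ x := by
    simpa using pow_le_pow_of_le_one hx0 hx1 (show 1 ≤ 5 by norm_num)
  have hx3 : x ^ 3 ≤ x := by
    simpa using pow_le_pow_of_le_one hx0 hx1 (show 1 ≤ 3 by norm_num)
  have hx30 : 0 ≤ x ^ 3 := by positivity
  have he' := abs_le.1 h
  have hb : |2 * (x - x ^ 3 / 6) + e| ≤ 3 * x := abs_le.2 ⟨by linarith, by linarith⟩
  have hprod : |e * (2 * (x - x ^ 3 / 6) + e)| ≤ x ^ 5 / 100 * (3 * x) := by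
    rw [abs_mul]; gcongr
  have hp := abs_le.1 hprod
  have hx6 : 0 ≤ x ^ 6 := by positivity
  have ht6 : t ^ 6 = 64 * x ^ 6 := by rw [ht2]; ring
  have hx6' : x ^ 5 / 100 * (3 * x) = 3 / 100 * x ^ 6 := by ring
  rw [hexpr, ht6, abs_le]
  rw [hx6'] at hp
  constructor <;> nlinarith [hp.1, hp.2]

/-- The geodesic radius on the unit sphere of a cap of Euclidean radius `ε`. -/
noncomputable def geodesicRadius (ε : ℝ) : ℝ := 2 * Real.arcsin (ε / 2)

theorem geodesicRadius_mem {ε : ℝ} (hε : ε ∈ Set.Ioc (0 : ℝ) 2) :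
    geodesicRadius ε ∈ Set.Ioc 0 (2 * ε) := by
  have h1 : 0 < Real.arcsin (ε / 2) := Real.arcsin_pos.2 (by linarith [hε.1])
  have h2 := Real.mul_le_sin h1.le (Real.arcsin_le_pi_div_two _)
  rw [Real.sin_arcsin (by linarith [hε.1]) (by linarith [hε.2])] at h2
  have h3 : 1 / 2 ≤ 2 / Real.pi := by
    rw [div_le_div_iff₀ two_pos Real.pi_pos]
    linarith [Real.pi_le_four]
  unfold geodesicRadius
  exact ⟨by linarith, by nlinarith⟩

theorem geodesicRadius_eventually :
    ∀ᶠ ε in 𝓝[>] (0 : ℝ), 0 < ε ∧ geodesicRadius ε ∈ Set.Ioc 0 (2 * ε) := by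
  filter_upwards [Ioc_mem_nhdsGT (zero_lt_two : (0 : ℝ) < 2)] with ε hε
    using ⟨hε.1, geodesicRadius_mem hε⟩

theorem hasQuadraticError_geodesicRadius_div :
    HasQuadraticError (fun ε => geodesicRadius ε / ε) 1 := by
  refine .of_abs_sub_le 1 ?_
  filter_upwards [Ioc_mem_nhdsGT (zero_lt_two : (0 : ℝ) < 2)] with ε hε
  obtain ⟨h0, h1⟩ := geodesicRadius_mem hε
  set y := Real.arcsin (ε / 2) with hy
  have hr : geodesicRadius ε = 2 * y := rfl
  rw [hr] at h0 h1 ⊢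
  have hy0 : 0 < y := by linarith
  have hs : Real.sin y = ε / 2 := Real.sin_arcsin (by linarith [hε.1]) (by linarith [hε.2])
  have h2 := Real.sin_lt hy0
  have h3 := Real.sin_gt_sub_cube hy0
  have h4 : y ^ 3 ≤ ε ^ 3 := pow_le_pow_left₀ hy0.le (by linarith) 3
  have h5 : 0 < ε ^ 3 := by have := hε.1; positivity
  rw [div_sub_one hε.1.ne', abs_div, abs_of_pos hε.1, div_le_iff₀ hε.1, abs_le]
  constructor <;> nlinarith

theorem HasQuadraticError.integral_geodesicRadius {f g : ℝ → ℝ} {c : ℝ} (k : ℕ)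
    (hf : Continuous f) (hfg : ∀ t, 0 < t → f t = t ^ k * g t) (hg : HasQuadraticError g c) :
    HasQuadraticError (fun ε => (∫ t in (0 : ℝ)..geodesicRadius ε, f t) / ε ^ (k + 1))
      (c / (k + 1)) := by
  obtain ⟨C, hC0, hC⟩ := hg.exists_nonneg
  obtain ⟨δ, hδ, hδC⟩ := mem_nhdsGT_iff_exists_Ioo_subset.1 hC.bound
  replace hδ : 0 < δ := hδ
  have hmain : HasQuadraticError
      (fun ε => ((∫ t in (0 : ℝ)..geodesicRadius ε, f t) - c * geodesicRadius ε ^ (k + 1) / (k + 1))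
        / ε ^ (k + 1)) 0 := by
    refine .of_abs_sub_le (C * 2 ^ (k + 3)) ?_
    filter_upwards [geodesicRadius_eventually, Ioo_mem_nhdsGT (half_pos hδ)] with ε ⟨hε, hr0, hr⟩ hεδ
    have hint : (∫ t in (0 : ℝ)..geodesicRadius ε, (f t - c * t ^ k)) =
        (∫ t in (0 : ℝ)..geodesicRadius ε, f t) - c * geodesicRadius ε ^ (k + 1) / (k + 1) := by
      rw [intervalIntegral.integral_sub (hf.intervalIntegrable _ _)
        (Continuous.intervalIntegrable (by fun_prop) _ _), intervalIntegral.integral_const_mul,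
        integral_pow]
      simp [mul_div_assoc]
    have hb : ‖∫ t in (0 : ℝ)..geodesicRadius ε, (f t - c * t ^ k)‖ ≤
        (C * (2 * ε) ^ (k + 2)) * |geodesicRadius ε - 0| := by
      refine intervalIntegral.norm_integral_le_of_norm_le_const fun t ht => ?_
      rw [Set.uIoc_of_le hr0.le] at ht
      have htδ : t ∈ Set.Ioo 0 δ := ⟨ht.1, by linarith [ht.2, hεδ.2]⟩
      have h1 : ‖g t - c‖ ≤ C * ‖t ^ 2‖ := hδC htδ
      have h0 := ht.1
      have ht2 : t ≤ 2 * ε := ht.2.trans hr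
      rw [hfg t h0, show t ^ k * g t - c * t ^ k = t ^ k * (g t - c) by ring, norm_mul,
        Real.norm_of_nonneg (by positivity : 0 ≤ t ^ k)]
      rw [Real.norm_of_nonneg (by positivity : 0 ≤ t ^ 2)] at h1
      calc t ^ k * ‖g t - c‖ ≤ t ^ k * (C * t ^ 2) := by gcongr
        _ = C * t ^ (k + 2) := by ring
        _ ≤ C * (2 * ε) ^ (k + 2) := by gcongr
    rw [hint, Real.norm_eq_abs, sub_zero, abs_of_pos hr0] at hb
    rw [sub_zero, abs_div, abs_of_pos (pow_pos hε _), div_le_iff₀ (pow_pos hε _)]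
    calc _ ≤ _ := hb
      _ ≤ (C * (2 * ε) ^ (k + 2)) * (2 * ε) := by gcongr
      _ = _ := by ring
  have h2 := hmain.add ((HasQuadraticError.const (c / (k + 1))).mul
    (hasQuadraticError_geodesicRadius_div.pow (k + 1)))
  rw [one_pow, mul_one, zero_add] at h2
  refine h2.congr' (Eventually.of_forall fun ε => ?_)
  simp only [div_pow]
  ring

/-- The integral of the radial profile `f` over a spherical cap, up to the measure of the unit
sphere of directions. -/
noncomputable def capIntegral (n : ℕ) (f : ℝ → ℝ) (ε : ℝ) : ℝ :=
  ∫ t in (0 : ℝ)..geodesicRadius ε, f t * Real.sin t ^ n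

theorem hasQuadraticError_capIntegral (n m j : ℕ) :
    HasQuadraticError
      (fun ε => capIntegral n (fun t => t ^ m * (1 - Real.cos t) ^ j) ε / ε ^ (n + m + 2 * j + 1))
      ((1 / 2) ^ j / ((n + m + 2 * j : ℕ) + 1)) := by
  refine HasQuadraticError.integral_geodesicRadius (n + m + 2 * j)
    (g := fun t => (Real.sin t / t) ^ n * ((1 - Real.cos t) / t ^ 2) ^ j)
    (by fun_prop) (fun t ht => ?_) ?_
  · have := ht.ne'
    simp only [div_pow]
    field_simp
    ring
  · simpa using (hasQuadraticError_sin_div.pow n).mul (hasQuadraticError_one_sub_cos_div.pow j)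

/-- The coefficient of the LLE kernel on the sphere, with regularizer `ε ^ (n + 9)`. -/
noncomputable def lleCoefficient (n : ℕ) (ε : ℝ) : ℝ :=
  capIntegral n (fun t => 1 - Real.cos t) ε /
    (capIntegral n (fun t => (1 - Real.cos t) ^ 2) ε + ε ^ (n + 9))

/-- The integral of the radial profile `f` against the LLE kernel on the sphere. -/
noncomputable def lleMoment (n : ℕ) (f : ℝ → ℝ) (ε : ℝ) : ℝ :=
  ∫ t in (0 : ℝ)..geodesicRadius ε,
    (1 - (1 - Real.cos t) * lleCoefficient n ε) * f t * Real.sin t ^ n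

theorem lleMoment_eq (n : ℕ) {f : ℝ → ℝ} (hf : Continuous f) (ε : ℝ) :
    lleMoment n f ε = capIntegral n f ε -
      lleCoefficient n ε * capIntegral n (fun t => f t * (1 - Real.cos t)) ε := by
  unfold lleMoment capIntegral
  rw [← intervalIntegral.integral_const_mul, ← intervalIntegral.integral_sub
    (Continuous.intervalIntegrable (by fun_prop) _ _)
    (Continuous.intervalIntegrable (by fun_prop) _ _)]
  exact intervalIntegral.integral_congr fun t _ => by ring

theorem hasQuadraticError_lleDenominator (n : ℕ) :
    HasQuadraticError (fun ε =>
      (capIntegral n (fun t => (1 - Real.cos t) ^ 2) ε + ε ^ (n + 9)) / ε ^ (n + 5))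
      (1 / (4 * (n + 5))) := by
  have h := (hasQuadraticError_capIntegral n 0 2).add (HasQuadraticError.sq.pow 2)
  have hc : ((1 / 2 : ℝ) ^ 2 / ((n + 0 + 2 * 2 : ℕ) + 1) + 0 ^ 2) = 1 / (4 * (n + 5)) := by
    push_cast
    field_simp
    ring
  rw [hc] at h
  refine h.congr' ?_
  filter_upwards [self_mem_nhdsWithin] with ε (hε : 0 < ε)
  have := hε.ne'
  simp only [pow_zero, one_mul]
  field_simp
  ring

theorem hasQuadraticError_lleCoefficient (n : ℕ) :
    HasQuadraticError (fun ε => ε ^ 2 * lleCoefficient n ε) (2 * (n + 5) / (n + 3)) := by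
  have h := (hasQuadraticError_capIntegral n 0 1).div (hasQuadraticError_lleDenominator n)
    (by positivity)
  have hc : ((1 / 2 : ℝ) ^ 1 / ((n + 0 + 2 * 1 : ℕ) + 1)) / (1 / (4 * (n + 5))) =
      2 * (n + 5) / (n + 3) := by
    push_cast
    field_simp
    ring
  rw [hc] at h
  refine h.congr' ?_
  filter_upwards [self_mem_nhdsWithin] with ε (hε : 0 < ε)
  have := hε.ne'
  simp only [pow_zero, one_mul, pow_one, lleCoefficient]
  rw [div_div_div_eq, mul_div_assoc', show n + 5 = n + 3 + 2 by ring, pow_add ε (n + 3) 2,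
    show n + 0 + 2 * 1 + 1 = n + 3 by ring,
    show ∀ a b c d : ℝ, a * (b * c) / (b * d) = b * (a * c) / (b * d) by intros; ring,
    mul_div_mul_left _ _ (by positivity), mul_comm _ (ε ^ 2)]

theorem hasQuadraticError_lleMoment_pow (n m : ℕ) :
    HasQuadraticError (fun ε => lleMoment n (fun t => t ^ m) ε / ε ^ (n + m + 1))
      (1 / (n + m + 1) - (n + 5) / ((n + 3) * (n + m + 3))) := by
  have h := (hasQuadraticError_capIntegral n m 0).sub
    ((hasQuadraticError_lleCoefficient n).mul (hasQuadraticError_capIntegral n m 1))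
  have hc : ((1 / 2 : ℝ) ^ 0 / ((n + m + 2 * 0 : ℕ) + 1) -
      2 * (n + 5) / (n + 3) * ((1 / 2) ^ 1 / ((n + m + 2 * 1 : ℕ) + 1))) =
      1 / (n + m + 1) - (n + 5) / ((n + 3) * (n + m + 3)) := by
    push_cast
    rw [show (n : ℝ) + m + 2 + 1 = n + m + 3 by ring]
    field_simp
    ring
  rw [hc] at h
  refine h.congr' ?_
  filter_upwards [self_mem_nhdsWithin] with ε (hε : 0 < ε)
  have := hε.ne'
  rw [lleMoment_eq n (by fun_prop)]
  simp only [pow_zero, mul_one, pow_one]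
  field_simp
  ring

theorem exists_eventually_abs_lleMoment_le (n : ℕ) :
    ∃ M, ∀ᶠ ε in 𝓝[>] (0 : ℝ), ∀ (f : ℝ → ℝ) (C : ℝ),
      (∀ t ∈ Set.Icc (0 : ℝ) 1, |f t| ≤ C * t ^ 6) → |lleMoment n f ε| ≤ C * M * ε ^ (n + 7) := by
  set b : ℝ := 2 * (n + 5) / (n + 3) + 1
  refine ⟨(1 + 2 * b) * 2 ^ (n + 7), ?_⟩
  have hb := (hasQuadraticError_lleCoefficient n).tendsto.abs
  have hb0 : |2 * ((n : ℝ) + 5) / (n + 3)| < b := by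
    rw [abs_of_nonneg (by positivity)]
    exact lt_add_one _
  filter_upwards [geodesicRadius_eventually, Ioo_mem_nhdsGT (half_pos (one_pos (α := ℝ))),
    hb.eventually_lt_const hb0] with ε ⟨hε, hr0, hr⟩ hε1 hβ f C hf
  have hC : 0 ≤ C := by simpa using (abs_nonneg _).trans (hf 1 (by simp))
  have hbound : ‖lleMoment n f ε‖ ≤
      ((1 + 2 * b) * (C * (2 * ε) ^ 6) * (2 * ε) ^ n) * |geodesicRadius ε - 0| := by
    refine intervalIntegral.norm_integral_le_of_norm_le_const fun t ht => ?_
    rw [Set.uIoc_of_le hr0.le] at ht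
    have ht2 : t ≤ 2 * ε := ht.2.trans hr
    have h0 := ht.1.le
    have hcos0 : 0 ≤ 1 - Real.cos t := sub_nonneg.2 (Real.cos_le_one t)
    have hcos1 : 1 - Real.cos t ≤ 2 * ε ^ 2 := by
      have := Real.one_sub_sq_div_two_le_cos (x := t)
      nlinarith
    have hK : |1 - (1 - Real.cos t) * lleCoefficient n ε| ≤ 1 + 2 * b := by
      refine (abs_sub _ _).trans ?_
      rw [abs_mul, abs_one, abs_of_nonneg hcos0]
      rw [abs_mul, abs_of_pos (pow_pos hε 2)] at hβ
      have : (1 - Real.cos t) * |lleCoefficient n ε| ≤ 2 * ε ^ 2 * |lleCoefficient n ε| := by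
        gcongr
      linarith
    have hft : |f t| ≤ C * (2 * ε) ^ 6 :=
      (hf t ⟨h0, by linarith [hε1.2]⟩).trans (by gcongr)
    have hsin : |Real.sin t ^ n| ≤ (2 * ε) ^ n := by
      rw [abs_pow]
      gcongr
      exact (Real.abs_sin_le_abs).trans (by rwa [abs_of_nonneg h0])
    rw [Real.norm_eq_abs, abs_mul, abs_mul]
    have hb' : 0 ≤ b := (abs_nonneg _).trans hb0.le
    gcongr
  have hb' : 0 ≤ b := (abs_nonneg _).trans hb0.le
  rw [Real.norm_eq_abs, sub_zero, abs_of_pos hr0] at hbound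
  calc _ ≤ _ := hbound
    _ ≤ ((1 + 2 * b) * (C * (2 * ε) ^ 6) * (2 * ε) ^ n) * (2 * ε) := by gcongr
    _ = _ := by ring

theorem lleMoment_one_sub_cos_isBigO (n : ℕ) :
    lleMoment n (fun t => 1 - Real.cos t) =O[𝓝[>] (0 : ℝ)] fun ε => ε ^ (n + 7) := by
  have hev : lleMoment n (fun t => 1 - Real.cos t) =ᶠ[𝓝[>] (0 : ℝ)]
      fun ε => (ε ^ 2 * lleCoefficient n ε) * ε ^ (n + 7) := by
    have hpos : (0 : ℝ) < 1 / (4 * (n + 5)) := by positivity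
    filter_upwards [self_mem_nhdsWithin,
      (hasQuadraticError_lleDenominator n).tendsto.eventually_ne hpos.ne'] with ε (hε : 0 < ε) hne
    have hne' : capIntegral n (fun t => (1 - Real.cos t) ^ 2) ε + ε ^ (n + 9) ≠ 0 :=
      (div_ne_zero_iff.1 hne).1
    rw [lleMoment_eq n (by fun_prop)]
    simp only [← sq]
    have : capIntegral n (fun t => 1 - Real.cos t) ε = lleCoefficient n ε *
        (capIntegral n (fun t => (1 - Real.cos t) ^ 2) ε + ε ^ (n + 9)) := by
      rw [lleCoefficient, div_mul_cancel₀ _ hne']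
    rw [this]
    ring
  refine hev.trans_isBigO ?_
  simpa using ((hasQuadraticError_lleCoefficient n).tendsto.isBigO_one ℝ).mul
    (isBigO_refl (fun ε : ℝ => ε ^ (n + 7)) (𝓝[>] 0))

theorem lleMoment_sq_sub_isBigO (n : ℕ) :
    (fun ε => lleMoment n (fun t => t ^ 2) ε - lleMoment n (fun t => t ^ 4) ε / 12)
      =O[𝓝[>] (0 : ℝ)] fun ε => ε ^ (n + 7) := by
  obtain ⟨M, hM⟩ := exists_eventually_abs_lleMoment_le n
  have h1 : lleMoment n (fun t => t ^ 2 - 2 * (1 - Real.cos t) - t ^ 4 / 12) =O[𝓝[>] (0 : ℝ)]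
      fun ε => ε ^ (n + 7) := by
    refine IsBigO.of_bound M ?_
    filter_upwards [hM, self_mem_nhdsWithin] with ε hε (hε0 : 0 < ε)
    rw [Real.norm_eq_abs, Real.norm_of_nonneg (by positivity)]
    simpa using hε _ 1 fun t ht => by simpa using abs_sq_sub_two_mul_one_sub_cos_le ht
  refine (h1.add ((lleMoment_one_sub_cos_isBigO n).const_mul_left 2)).congr_left fun ε => ?_
  unfold lleMoment
  rw [← intervalIntegral.integral_const_mul, ← intervalIntegral.integral_div,
    ← intervalIntegral.integral_add (Continuous.intervalIntegrable (by fun_prop) _ _)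
    (Continuous.intervalIntegrable (by fun_prop) _ _), ← intervalIntegral.integral_sub
    (Continuous.intervalIntegrable (by fun_prop) _ _)
    (Continuous.intervalIntegrable (by fun_prop) _ _)]
  exact intervalIntegral.integral_congr fun t _ => by ring

theorem lleMoment_sub_sum (n : ℕ) {f : ℝ → ℝ} (hf : Continuous f) (s : Finset ℕ) (a : ℕ → ℝ)
    (ε : ℝ) :
    lleMoment n (fun t => f t - ∑ k ∈ s, t ^ k / k.factorial * a k) ε =
      lleMoment n f ε - ∑ k ∈ s, a k / k.factorial * lleMoment n (fun t => t ^ k) ε := by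
  unfold lleMoment
  simp_rw [← intervalIntegral.integral_const_mul]
  rw [← intervalIntegral.integral_finsetSum fun k _ =>
    Continuous.intervalIntegrable (by fun_prop) _ _, ← intervalIntegral.integral_sub
    (Continuous.intervalIntegrable (by fun_prop) _ _)
    (Continuous.intervalIntegrable (by fun_prop) _ _)]
  refine intervalIntegral.integral_congr fun t _ => ?_
  simp only [mul_sub, sub_mul, Finset.mul_sum, Finset.sum_mul]
  congr 1
  exact Finset.sum_congr rfl fun k _ => by ring

theorem setIntegral_sphere_iteratedDeriv_smul_of_odd {E : Type*} [NormedAddCommGroup E]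
    [NormedSpace ℝ E] [MeasurableSpace E] {σ : Measure E} {F : E → ℝ}
    (hneg : ∀ f : E → ℝ, ∫ θ in Metric.sphere 0 1, f (-θ) ∂σ = ∫ θ in Metric.sphere 0 1, f θ ∂σ)
    (hF : ContDiff ℝ (⊤ : ℕ∞) F) {k : ℕ} (hk : Odd k) :
    ∫ θ in Metric.sphere (0 : E) 1, iteratedDeriv k (fun s : ℝ => F (s • θ)) 0 ∂σ = 0 := by
  have h := hneg fun θ => iteratedDeriv k (fun s : ℝ => F (s • θ)) 0
  simp only [iteratedDeriv_smul_neg_zero hF, hk.neg_one_pow, neg_one_mul, integral_neg] at h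
  linarith

section Sphere

variable {E : Type*} [NormedAddCommGroup E] [NormedSpace ℝ E] [ProperSpace E]
  [MeasurableSpace E] [BorelSpace E] {σ : Measure E} {F : E → ℝ}

theorem setIntegral_sphere_lleMoment_sub_isBigO (n : ℕ) (hfin : σ (Metric.sphere (0 : E) 1) ≠ ⊤)
    (hneg : ∀ f : E → ℝ, ∫ θ in Metric.sphere 0 1, f (-θ) ∂σ = ∫ θ in Metric.sphere 0 1, f θ ∂σ)
    (hF : ContDiff ℝ (⊤ : ℕ∞) F) :
    (fun ε => (∫ θ in Metric.sphere (0 : E) 1, lleMoment n (fun t => F (t • θ)) ε ∂σ) -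
      (F 0 * σ.real (Metric.sphere (0 : E) 1) * lleMoment n (fun t => t ^ 0) ε +
        (∫ θ in Metric.sphere (0 : E) 1, iteratedDeriv 2 (fun s : ℝ => F (s • θ)) 0 ∂σ) / 2 *
          lleMoment n (fun t => t ^ 2) ε +
        (∫ θ in Metric.sphere (0 : E) 1, iteratedDeriv 4 (fun s : ℝ => F (s • θ)) 0 ∂σ) / 24 *
          lleMoment n (fun t => t ^ 4) ε))
      =O[𝓝[>] (0 : ℝ)] fun ε => ε ^ (n + 7) := by
  have hcompact : IsCompact (Metric.sphere (0 : E) 1) := isCompact_sphere 0 1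
  have hint {f : E → ℝ} (hf : Continuous f) : IntegrableOn f (Metric.sphere (0 : E) 1) σ :=
    hf.continuousOn.integrableOn_of_subset_isCompact hcompact hcompact.measurableSet
      subset_rfl hfin
  obtain ⟨M, hM⟩ := exists_eventually_abs_lleMoment_le n
  obtain ⟨C, hC⟩ := exists_forall_abs_sub_taylor_smul_le hF 5
  have hFc : Continuous F := hF.continuous
  have hcont (ε : ℝ) : Continuous fun θ : E => lleMoment n (fun t => F (t • θ)) ε :=
    intervalIntegral.continuous_parametric_intervalIntegral_of_continuous'
      (by unfold Function.uncurry; fun_prop) _ _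
  refine IsBigO.of_bound (C * M * σ.real (Metric.sphere (0 : E) 1)) ?_
  filter_upwards [hM, self_mem_nhdsWithin] with ε hε (hε0 : 0 < ε)
  have hsum : (∫ θ in Metric.sphere (0 : E) 1, ∑ k ∈ Finset.range (5 + 1),
        iteratedDeriv k (fun s : ℝ => F (s • θ)) 0 / k.factorial * lleMoment n (fun t => t ^ k) ε ∂σ) =
      F 0 * σ.real (Metric.sphere (0 : E) 1) * lleMoment n (fun t => t ^ 0) ε +
        (∫ θ in Metric.sphere (0 : E) 1, iteratedDeriv 2 (fun s : ℝ => F (s • θ)) 0 ∂σ) / 2 *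
          lleMoment n (fun t => t ^ 2) ε +
        (∫ θ in Metric.sphere (0 : E) 1, iteratedDeriv 4 (fun s : ℝ => F (s • θ)) 0 ∂σ) / 24 *
          lleMoment n (fun t => t ^ 4) ε := by
    rw [integral_finsetSum _ fun k _ =>
      hint (((continuous_iteratedDeriv_smul_zero hF k).div_const _).mul_const _)]
    simp only [integral_mul_const, integral_div, Finset.sum_range_succ, Finset.sum_range_zero]
    rw [setIntegral_sphere_iteratedDeriv_smul_of_odd hneg hF (k := 1) (by decide),
      setIntegral_sphere_iteratedDeriv_smul_of_odd hneg hF (k := 3) (by decide),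
      setIntegral_sphere_iteratedDeriv_smul_of_odd hneg hF (k := 5) (by decide)]
    simp only [iteratedDeriv_zero, zero_smul, setIntegral_const, smul_eq_mul, Nat.factorial]
    push_cast
    ring
  rw [← hsum, ← integral_sub (hint (hcont ε)) (hint (continuous_finsetSum _ fun k _ =>
    ((continuous_iteratedDeriv_smul_zero hF k).div_const _).mul_const _))]
  refine (norm_setIntegral_le_of_norm_le_const (C := C * M * ε ^ (n + 7)) hfin.lt_top
    fun θ hθ => ?_).trans_eq ?_
  · rw [← lleMoment_sub_sum n (by fun_prop), Real.norm_eq_abs]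
    exact hε _ C fun t ht => hC θ hθ t ht
  · rw [Real.norm_of_nonneg (by positivity)]
    ring

theorem lle_sphere_expansion (n : ℕ) (hfin : σ (Metric.sphere (0 : E) 1) ≠ ⊤)
    (hpos : σ (Metric.sphere (0 : E) 1) ≠ 0)
    (hneg : ∀ f : E → ℝ, ∫ θ in Metric.sphere 0 1, f (-θ) ∂σ = ∫ θ in Metric.sphere 0 1, f θ ∂σ)
    (hF : ContDiff ℝ (⊤ : ℕ∞) F) :
    (fun ε =>
        ((∫ θ in Metric.sphere (0 : E) 1, lleMoment n (fun t => F (t • θ)) ε ∂σ) /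
            (∫ _θ in Metric.sphere (0 : E) 1, lleMoment n (fun t => t ^ 0) ε ∂σ) - F 0) -
          (-(((n + 1) * (n + 3)) /
              (24 * σ.real (Metric.sphere (0 : E) 1) * (n + 5) * (n + 7))) *
            ((∫ θ in Metric.sphere (0 : E) 1, iteratedDeriv 4 (fun s : ℝ => F (s • θ)) 0 ∂σ) +
              (∫ θ in Metric.sphere (0 : E) 1, iteratedDeriv 2 (fun s : ℝ => F (s • θ)) 0 ∂σ)) *
                ε ^ 4))
      =O[𝓝[>] (0 : ℝ)] fun ε => ε ^ 6 := by
  have hN := setIntegral_sphere_lleMoment_sub_isBigO n hfin hneg hF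
  simp only [setIntegral_const, smul_eq_mul]
  have hs : σ.real (Metric.sphere (0 : E) 1) ≠ 0 := (ENNReal.toReal_pos hpos hfin).ne'
  set s := σ.real (Metric.sphere (0 : E) 1)
  set N := fun ε => ∫ θ in Metric.sphere (0 : E) 1, lleMoment n (fun t => F (t • θ)) ε ∂σ
  set P4 := ∫ θ in Metric.sphere (0 : E) 1, iteratedDeriv 4 (fun s : ℝ => F (s • θ)) 0 ∂σ
  set P2 := ∫ θ in Metric.sphere (0 : E) 1, iteratedDeriv 2 (fun s : ℝ => F (s • θ)) 0 ∂σ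
  have hA0 := hasQuadraticError_lleMoment_pow n 0
  have hA4 := hasQuadraticError_lleMoment_pow n 4
  have hA2 := lleMoment_sq_sub_isBigO n
  have hc0 : (1 / ((n : ℝ) + (0 : ℕ) + 1) - (n + 5) / ((n + 3) * (n + (0 : ℕ) + 3))) =
      4 / ((n + 1) * (n + 3) ^ 2) := by
    push_cast
    rw [add_zero]
    field_simp
    ring
  have hc4 : (1 / ((n : ℝ) + (4 : ℕ) + 1) - (n + 5) / ((n + 3) * (n + (4 : ℕ) + 3))) =
      -4 / ((n + 3) * (n + 5) * (n + 7)) := by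
    push_cast
    rw [show (n : ℝ) + 4 + 1 = n + 5 by ring, show (n : ℝ) + 4 + 3 = n + 7 by ring]
    field_simp
    ring
  rw [hc0] at hA0
  rw [hc4] at hA4
  have hc0' : (4 : ℝ) / ((n + 1) * (n + 3) ^ 2) ≠ 0 := by positivity
  have hq := hA4.div hA0 hc0'
  have hcq : (-4 : ℝ) / ((n + 3) * (n + 5) * (n + 7)) / (4 / ((n + 1) * (n + 3) ^ 2)) =
      -(((n + 1) * (n + 3)) / ((n + 5) * (n + 7))) := by
    field_simp
  rw [hcq] at hq
  have hinv := (hA0.inv hc0').tendsto.isBigO_one ℝ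
  have hratio := (IsBigO.mul hq (isBigO_refl (fun ε : ℝ => ε ^ 4) (𝓝[>] 0))).const_mul_left
    ((P4 + P2) / (24 * s))
  have herr := (((hA2.const_mul_left (P2 / 2)).add hN).const_mul_left s⁻¹).mul hinv
  have herr' : (fun ε => s⁻¹ * (P2 / 2 * (lleMoment n (fun t => t ^ 2) ε -
      lleMoment n (fun t => t ^ 4) ε / 12) + (N ε - (F 0 * s * lleMoment n (fun t => t ^ 0) ε +
        P2 / 2 * lleMoment n (fun t => t ^ 2) ε + P4 / 24 * lleMoment n (fun t => t ^ 4) ε))) /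
          lleMoment n (fun t => t ^ 0) ε) =O[𝓝[>] (0 : ℝ)] fun ε => ε ^ 6 := by
    refine (herr.mul (isBigO_refl (fun ε : ℝ => (ε ^ (n + 1))⁻¹) (𝓝[>] 0))).congr' ?_ ?_
    · filter_upwards [self_mem_nhdsWithin] with ε (hε : 0 < ε)
      have := hε.ne'
      simp only [add_zero, inv_div, N]
      field_simp
    · filter_upwards [self_mem_nhdsWithin] with ε (hε : 0 < ε)
      have := hε.ne'
      field_simp
      ring
  refine (hratio.congr_right fun ε => by ring).add herr' |>.congr' ?_ EventuallyEq.rfl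
  filter_upwards [self_mem_nhdsWithin, hA0.tendsto.eventually_ne hc0'] with ε (hε : 0 < ε) hne
  have hε' := hε.ne'
  have hne' : lleMoment n (fun t => t ^ 0) ε ≠ 0 := (div_ne_zero_iff.1 hne).1
  change _ = N ε / _ - F 0 - _
  generalize lleMoment n (fun t => t ^ 0) ε = A0 at *
  generalize lleMoment n (fun t => t ^ 2) ε = A2 at *
  generalize lleMoment n (fun t => t ^ 4) ε = A4 at *
  generalize N ε = Nε at *
  have hdiv : A4 / ε ^ (n + 4 + 1) / (A0 / ε ^ (n + 0 + 1)) * ε ^ 4 = A4 / A0 := by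
    field_simp
    ring
  rw [sub_mul, hdiv]
  field_simp
  ring

end Sphere

/-- Sphere example of Section 4.1: the LLE integral operator on `S^{p-1}` with uniform
sampling and regularization order `ρ = 8` produces a fourth-order differential operator
at order `ε⁴`. -/
theorem sphere_lle_fourth_order
    (p : ℕ) (hp : 3 ≤ p)
    (F : EuclideanSpace ℝ (Fin (p - 1)) → ℝ) (hF : ContDiff ℝ (⊤ : ℕ∞) F)
    (r β : ℝ → ℝ) (K : ℝ → ℝ → ℝ)
    (hr : ∀ ε, r ε = 2 * Real.arcsin (ε / 2))
    (hβ : ∀ ε, β ε =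
      (∫ t in (0 : ℝ)..(r ε), (1 - Real.cos t) * Real.sin t ^ (p - 2)) /
        ((∫ t in (0 : ℝ)..(r ε), (1 - Real.cos t) ^ 2 * Real.sin t ^ (p - 2)) + ε ^ (p + 7)))
    (hK : ∀ ε t, K ε t = 1 - (1 - Real.cos t) * β ε)
    (S : Set (EuclideanSpace ℝ (Fin (p - 1))))
    (hS : S = Metric.sphere (0 : EuclideanSpace ℝ (Fin (p - 1))) 1)
    (σ : Measure (EuclideanSpace ℝ (Fin (p - 1))))
    (hσ : σ = μH[(p : ℝ) - 2]) :
    (fun ε =>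
        ((∫ θ in S, (∫ t in (0 : ℝ)..(r ε), K ε t * F (t • θ) * Real.sin t ^ (p - 2)) ∂σ) /
            (∫ θ in S, (∫ t in (0 : ℝ)..(r ε), K ε t * Real.sin t ^ (p - 2)) ∂σ) - F 0) -
          (-(((p : ℝ) ^ 2 - 1) /
              (24 * (σ S).toReal * ((p : ℝ) + 3) * ((p : ℝ) + 5))) *
            ((∫ θ in S, iteratedDeriv 4 (fun s : ℝ => F (s • θ)) 0 ∂σ) +
              (∫ θ in S, iteratedDeriv 2 (fun s : ℝ => F (s • θ)) 0 ∂σ)) * ε ^ 4))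
      =O[𝓝[>] (0 : ℝ)] fun ε => ε ^ 6 := by
  obtain ⟨m, rfl⟩ : ∃ m, p = m + 3 := ⟨p - 3, by omega⟩
  have hd : ((m + 3 : ℕ) : ℝ) - 2 = ((m + 1 : ℕ) : ℝ) := by
    push_cast
    ring
  rw [hd] at hσ
  subst hσ hS
  have hr' : r = geodesicRadius := funext hr
  have hβ' : β = lleCoefficient (m + 1) := funext fun ε => by
    rw [hβ ε, hr']
    rfl
  have hmain := lle_sphere_expansion (σ := μH[(m + 1 : ℕ)]) (m + 1)
    (hausdorffMeasure_sphere_lt_top m).ne (hausdorffMeasure_sphere_pos m).ne'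
    (setIntegral_sphere_hausdorffMeasure_neg _) hF
  refine hmain.congr_left fun ε => ?_
  have hN (θ : EuclideanSpace ℝ (Fin (m + 3 - 1))) :
      (∫ t in (0 : ℝ)..r ε, K ε t * F (t • θ) * Real.sin t ^ (m + 3 - 2)) =
        lleMoment (m + 1) (fun t => F (t • θ)) ε := by
    simp only [hK, hr', hβ']
    rfl
  have hD : (∫ t in (0 : ℝ)..r ε, K ε t * Real.sin t ^ (m + 3 - 2)) =
      lleMoment (m + 1) (fun t => t ^ 0) ε := by
    simp only [hK, hr', hβ', lleMoment, pow_zero, mul_one]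
    rfl
  simp only [hN, hD]
  congr 4
  push_cast
  congr 1
  · ring
  · rw [Measure.real]
    ring
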